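/- GW_p^Z is a pseudometric: Let (Z, d_Z) be a separable metric space and p ∈ [1,∞). For all (Z,p)-networks X, Y one has GW_p^Z(X,Y) = GW_p^Z(Y,X) ≥ 0, and for all (Z,p)-networks X₁, X₂, X₃ the triangle inequality GW_p^Z(X₁, X₃) ≤ GW_p^Z(X₁, X₂) + GW_p^Z(X₂, X₃) holds. -/

import Mathlib

open MeasureTheory

noncomputable section

/-- The set of couplings of two measures: probability measures on the product
whose marginals are `μ` and `ν`. -/
def Couplings {X Y : Type*} [MeasurableSpace X] [MeasurableSpace Y]
    (μ : Measure X) (ν : Measure Y) : Set (Measure (X × Y)) :=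
  {π | IsProbabilityMeasure π ∧ π.map Prod.fst = μ ∧ π.map Prod.snd = ν}

/-- The `p`-distortion of a coupling `π`, for kernels `ωX`, `ωY` valued in a
(pseudo)metric space `Z`. -/
def dis {X Y Z : Type*} [MeasurableSpace X] [MeasurableSpace Y] [PseudoMetricSpace Z]
    (p : ℝ) (ωX : X × X → Z) (ωY : Y × Y → Z) (π : Measure (X × Y)) : ℝ :=
  (∫ w : X × Y, ∫ w' : X × Y,
      dist (ωX (w.1, w'.1)) (ωY (w.2, w'.2)) ^ p ∂π ∂π) ^ (1 / p)

/-- The `Z`-Gromov–Wasserstein `p`-distance between `(X, ωX, μX)` and `(Y, ωY, μY)`. -/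
def GW {X Y Z : Type*} [MeasurableSpace X] [MeasurableSpace Y] [PseudoMetricSpace Z]
    (p : ℝ) (ωX : X × X → Z) (μX : Measure X) (ωY : Y × Y → Z) (μY : Measure Y) : ℝ :=
  (1 / 2) * sInf (dis p ωX ωY '' Couplings μX μY)

/-- `(X, ω, μ)` is a `(Z,p)`-network: `μ` is a Borel probability measure, `ω` is Borel
measurable, and `∬ d_Z(ω(x,x'), z₀)^p dμ dμ < ∞` for some `z₀`. -/
structure IsNetwork {X Z : Type*} [MeasurableSpace X] [MeasurableSpace Z] [PseudoMetricSpace Z]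
    (p : ℝ) (ω : X × X → Z) (μ : Measure X) : Prop where
  prob : IsProbabilityMeasure μ
  meas : Measurable ω
  integ : ∃ z₀ : Z, (∫⁻ x, ∫⁻ x', ENNReal.ofReal (dist (ω (x, x')) z₀ ^ p) ∂μ ∂μ) < ⊤

section

variable {Ω X Y Z : Type*} [MeasurableSpace Ω] [MeasurableSpace X] [MeasurableSpace Y]
  {p : ℝ} {ωX : X × X → Z} {ωY : Y × Y → Z} {μ : Measure X} {ν : Measure Y}

lemma prod_mem_couplings [IsProbabilityMeasure μ] [IsProbabilityMeasure ν] :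
    μ.prod ν ∈ Couplings μ ν :=
  ⟨inferInstance, by simp, by simp⟩

lemma map_swap_mem_couplings {π : Measure (X × Y)} (hπ : π ∈ Couplings μ ν) :
    π.map Prod.swap ∈ Couplings ν μ := by
  obtain ⟨hprob, hfst, hsnd⟩ := hπ
  refine ⟨Measure.isProbabilityMeasure_map measurable_swap.aemeasurable, ?_, ?_⟩
  · rw [Measure.map_map measurable_fst measurable_swap]
    exact hsnd
  · rw [Measure.map_map measurable_snd measurable_swap]
    exact hfst

lemma dis_map_swap [PseudoMetricSpace Z] (p : ℝ) (ωX : X × X → Z) (ωY : Y × Y → Z)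
    (π : Measure (X × Y)) : dis p ωY ωX (π.map Prod.swap) = dis p ωX ωY π := by
  have hswap : π.map Prod.swap = π.map (MeasurableEquiv.prodComm (α := X) (β := Y)) := rfl
  simp only [dis, hswap, integral_map_equiv]
  simp [MeasurableEquiv.prodComm, dist_comm]

lemma image_dis_couplings_subset_swap [PseudoMetricSpace Z] (p : ℝ) (ωX : X × X → Z)
    (ωY : Y × Y → Z) (μ : Measure X) (ν : Measure Y) :
    dis p ωX ωY '' Couplings μ ν ⊆ dis p ωY ωX '' Couplings ν μ := by
  rintro _ ⟨π, hπ, rfl⟩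
  exact ⟨_, map_swap_mem_couplings hπ, dis_map_swap p ωX ωY π⟩

lemma GW_comm [PseudoMetricSpace Z] (p : ℝ) (ωX : X × X → Z) (μ : Measure X)
    (ωY : Y × Y → Z) (ν : Measure Y) : GW p ωX μ ωY ν = GW p ωY ν ωX μ := by
  rw [GW, GW, (image_dis_couplings_subset_swap p ωX ωY μ ν).antisymm
    (image_dis_couplings_subset_swap p ωY ωX ν μ)]

lemma dis_nonneg [PseudoMetricSpace Z] (p : ℝ) (ωX : X × X → Z) (ωY : Y × Y → Z)
    (π : Measure (X × Y)) : 0 ≤ dis p ωX ωY π :=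
  Real.rpow_nonneg
    (integral_nonneg fun _ => integral_nonneg fun _ => Real.rpow_nonneg dist_nonneg _) _

lemma GW_nonneg [PseudoMetricSpace Z] (p : ℝ) (ωX : X × X → Z) (μ : Measure X)
    (ωY : Y × Y → Z) (ν : Measure Y) : 0 ≤ GW p ωX μ ωY ν := by
  refine mul_nonneg (by norm_num) (Real.sInf_nonneg ?_)
  rintro _ ⟨π, -, rfl⟩
  exact dis_nonneg p ωX ωY π

variable [PseudoMetricSpace Z] [MeasurableSpace Z]

lemma IsNetwork.exists_memLp_dist [OpensMeasurableSpace Z] (h : IsNetwork p ωX μ) (hp : 1 ≤ p) :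
    ∃ z : Z, MemLp (fun x => dist (ωX x) z) (ENNReal.ofReal p) (μ.prod μ) := by
  have := h.prob
  obtain ⟨z, hz⟩ := h.integ
  have hp₀ : 0 < p := by linarith
  have hmeas : Measurable fun x => dist (ωX x) z :=
    (continuous_id.dist continuous_const).measurable.comp h.meas
  refine ⟨z, hmeas.aestronglyMeasurable, ?_⟩
  rw [eLpNorm_lt_top_iff_lintegral_rpow_enorm_lt_top (by simpa using hp₀) ENNReal.ofReal_ne_top,
    ENNReal.toReal_ofReal hp₀.le, lintegral_prod _ (hmeas.enorm.pow_const p).aemeasurable]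
  convert hz using 5 with x x'
  rw [Real.enorm_of_nonneg dist_nonneg, ENNReal.ofReal_rpow_of_nonneg dist_nonneg hp₀.le]

variable [BorelSpace Z] [SecondCountableTopology Z] {γ : Measure Ω} {u : Ω → X} {v : Ω → Y}

lemma IsNetwork.memLp_dist (hX : IsNetwork p ωX μ) (hY : IsNetwork p ωY ν) (hp : 1 ≤ p)
    [IsProbabilityMeasure γ] (hu : MeasurePreserving u γ μ) (hv : MeasurePreserving v γ ν) :
    MemLp (fun w : Ω × Ω => dist (ωX (u w.1, u w.2)) (ωY (v w.1, v w.2)))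
      (ENNReal.ofReal p) (γ.prod γ) := by
  have := hX.prob
  have := hY.prob
  obtain ⟨x₀, hx⟩ := hX.exists_memLp_dist hp
  obtain ⟨y₀, hy⟩ := hY.exists_memLp_dist hp
  have hX' := hx.comp_measurePreserving (hu.prod hu)
  have hY' := hy.comp_measurePreserving (hv.prod hv)
  refine ((hX'.add (memLp_const (dist x₀ y₀))).add hY').mono' ?_ (.of_forall fun w => ?_)
  · exact ((hX.meas.comp (hu.prod hu).measurable).dist
      (hY.meas.comp (hv.prod hv).measurable)).aestronglyMeasurable
  · rw [Real.norm_of_nonneg dist_nonneg]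
    have h₁ := dist_triangle4 (ωX (u w.1, u w.2)) x₀ y₀ (ωY (v w.1, v w.2))
    rw [dist_comm y₀] at h₁
    exact h₁

lemma IsNetwork.dis_map_eq_lpNorm (hX : IsNetwork p ωX μ) (hY : IsNetwork p ωY ν) (hp : 1 ≤ p)
    [IsProbabilityMeasure γ] (hu : MeasurePreserving u γ μ) (hv : MeasurePreserving v γ ν) :
    dis p ωX ωY (γ.map fun w => (u w, v w)) =
      lpNorm (fun w : Ω × Ω => dist (ωX (u w.1, u w.2)) (ωY (v w.1, v w.2)))
        (ENNReal.ofReal p) (γ.prod γ) := by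
  have hp₀ : 0 < p := by linarith
  have hp' : ENNReal.ofReal p ≠ 0 := by simpa using hp₀
  have huv : Measurable fun w => (u w, v w) := hu.measurable.prodMk hv.measurable
  set π := γ.map fun w => (u w, v w) with hπ
  have : IsProbabilityMeasure π := Measure.isProbabilityMeasure_map huv.aemeasurable
  have hγπ : MeasurePreserving (fun w => (u w, v w)) γ π := ⟨huv, rfl⟩
  have hfst : MeasurePreserving Prod.fst π μ :=
    ⟨measurable_fst, by rw [hπ, Measure.map_map measurable_fst huv]; exact hu.map_eq⟩
  have hsnd : MeasurePreserving Prod.snd π ν :=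
    ⟨measurable_snd, by rw [hπ, Measure.map_map measurable_snd huv]; exact hv.map_eq⟩
  have hmem := hX.memLp_dist hY hp hfst hsnd
  have hint := hmem.integrable_norm_rpow hp' ENNReal.ofReal_ne_top
  have hcomp := eLpNorm_comp_measurePreserving (p := ENNReal.ofReal p) hmem.1 (hγπ.prod hγπ)
  have hlp := congrArg ENNReal.toReal hcomp
  rw [toReal_eLpNorm (hmem.comp_measurePreserving (hγπ.prod hγπ)).1, toReal_eLpNorm hmem.1] at hlp
  refine Eq.trans ?_ hlp.symm
  rw [lpNorm_eq_integral_norm_rpow_toReal hp' ENNReal.ofReal_ne_top hmem.1, integral_prod _ hint]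
  simp [dis, ENNReal.toReal_ofReal hp₀.le]

end

section

variable {X Y W : Type*} [MeasurableSpace X] [MeasurableSpace Y] [MeasurableSpace W]

/-- Gluing of two measures on products along their common marginal. -/
lemma exists_gluing [StandardBorelSpace W] [Nonempty W]
    (π : Measure (X × Y)) (ρ : Measure (Y × W)) [IsProbabilityMeasure π] [IsProbabilityMeasure ρ]
    (h : π.map Prod.snd = ρ.map Prod.fst) :
    ∃ γ : Measure ((X × Y) × W), IsProbabilityMeasure γ ∧ γ.map Prod.fst = π ∧
      γ.map (fun w => (w.1.2, w.2)) = ρ := by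
  let κ : ProbabilityTheory.Kernel (X × Y) W :=
    ρ.condKernel.comap (Prod.snd : X × Y → Y) measurable_snd
  refine ⟨π.compProd κ, inferInstance, Measure.fst_compProd π κ, ?_⟩
  ext s hs
  have hm : Measurable fun w : (X × Y) × W => (w.1.2, w.2) := by fun_prop
  rw [Measure.map_apply hm hs, Measure.compProd_apply (hm hs)]
  conv_rhs => rw [← ρ.disintegrate ρ.condKernel, Measure.compProd_apply hs, Measure.fst, ← h]
  rw [lintegral_map (ProbabilityTheory.Kernel.measurable_kernel_prodMk_left hs) measurable_snd]
  rfl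

variable {Z : Type*} [PseudoMetricSpace Z] [MeasurableSpace Z] [BorelSpace Z]
  [SecondCountableTopology Z] {p : ℝ} {ωX : X × X → Z} {ωY : Y × Y → Z} {ωW : W × W → Z}
  {μ : Measure X} {ν : Measure Y} {ξ : Measure W}

lemma IsNetwork.exists_coupling_dis_le_add [StandardBorelSpace W] (hX : IsNetwork p ωX μ)
    (hY : IsNetwork p ωY ν) (hW : IsNetwork p ωW ξ) (hp : 1 ≤ p)
    {π : Measure (X × Y)} (hπ : π ∈ Couplings μ ν)
    {ρ : Measure (Y × W)} (hρ : ρ ∈ Couplings ν ξ) :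
    ∃ σ ∈ Couplings μ ξ, dis p ωX ωW σ ≤ dis p ωX ωY π + dis p ωY ωW ρ := by
  have := hW.prob
  have : Nonempty W := ξ.nonempty_of_neZero
  obtain ⟨hπprob, hπfst, hπsnd⟩ := hπ
  obtain ⟨hρprob, hρfst, hρsnd⟩ := hρ
  obtain ⟨γ, hγ, hγπ, hγρ⟩ := exists_gluing π ρ (hπsnd.trans hρfst.symm)
  have hm : Measurable fun w : (X × Y) × W => (w.1.2, w.2) := by fun_prop
  have hx : MeasurePreserving (fun w : (X × Y) × W => w.1.1) γ μ :=
    ⟨by fun_prop, by rw [← hπfst, ← hγπ, Measure.map_map measurable_fst measurable_fst]; rfl⟩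
  have hy : MeasurePreserving (fun w : (X × Y) × W => w.1.2) γ ν :=
    ⟨by fun_prop, by rw [← hπsnd, ← hγπ, Measure.map_map measurable_snd measurable_fst]; rfl⟩
  have hw : MeasurePreserving (fun w : (X × Y) × W => w.2) γ ξ :=
    ⟨by fun_prop, by rw [← hρsnd, ← hγρ, Measure.map_map measurable_snd hm]; rfl⟩
  have hxw : Measurable fun w : (X × Y) × W => (w.1.1, w.2) := by fun_prop
  refine ⟨γ.map fun w => (w.1.1, w.2),
    ⟨Measure.isProbabilityMeasure_map hxw.aemeasurable, ?_, ?_⟩, ?_⟩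
  · rw [Measure.map_map measurable_fst hxw]
    exact hx.map_eq
  · rw [Measure.map_map measurable_snd hxw]
    exact hw.map_eq
  have hπ' : π = γ.map fun w => (w.1.1, w.1.2) := hγπ.symm
  have hp' : 1 ≤ ENNReal.ofReal p := by simpa using ENNReal.ofReal_le_ofReal hp
  have hxy := hX.memLp_dist hY hp hx hy
  have hyw := hY.memLp_dist hW hp hy hw
  rw [hπ', ← hγρ, hX.dis_map_eq_lpNorm hW hp hx hw, hX.dis_map_eq_lpNorm hY hp hx hy,
    hY.dis_map_eq_lpNorm hW hp hy hw]
  refine (lpNorm_mono_real (hxy.add hyw) fun w => ?_).trans (lpNorm_add_le hxy hp')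
  rw [Real.norm_of_nonneg dist_nonneg]
  exact dist_triangle _ _ _

lemma IsNetwork.GW_triangle [StandardBorelSpace W] (hX : IsNetwork p ωX μ)
    (hY : IsNetwork p ωY ν) (hW : IsNetwork p ωW ξ) (hp : 1 ≤ p) :
    GW p ωX μ ωW ξ ≤ GW p ωX μ ωY ν + GW p ωY ν ωW ξ := by
  have := hX.prob
  have := hY.prob
  have := hW.prob
  have hbdd : BddBelow (dis p ωX ωW '' Couplings μ ξ) := by
    refine ⟨0, ?_⟩
    rintro _ ⟨σ, -, rfl⟩
    exact dis_nonneg p ωX ωW σ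
  have key : sInf (dis p ωX ωW '' Couplings μ ξ) ≤
      sInf (dis p ωX ωY '' Couplings μ ν) + sInf (dis p ωY ωW '' Couplings ν ξ) := by
    rw [← sub_le_iff_le_add]
    refine le_csInf ⟨_, _, prod_mem_couplings, rfl⟩ ?_
    rintro _ ⟨π, hπ, rfl⟩
    rw [sub_le_comm]
    refine le_csInf ⟨_, _, prod_mem_couplings, rfl⟩ ?_
    rintro _ ⟨ρ, hρ, rfl⟩
    obtain ⟨σ, hσ, hle⟩ := hX.exists_coupling_dis_le_add hY hW hp hπ hρ
    have := csInf_le hbdd ⟨σ, hσ, rfl⟩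
    linarith
  unfold GW
  linarith

end

/-- **`GW_p^Z` is a pseudometric**: it is symmetric, nonnegative, and satisfies the
triangle inequality on `(Z,p)`-networks. -/
theorem gw_pseudometric
    {X₁ X₂ X₃ Z : Type*}
    [MeasurableSpace X₁] [TopologicalSpace X₁] [PolishSpace X₁] [BorelSpace X₁]
    [MeasurableSpace X₂] [TopologicalSpace X₂] [PolishSpace X₂] [BorelSpace X₂]
    [MeasurableSpace X₃] [TopologicalSpace X₃] [PolishSpace X₃] [BorelSpace X₃]
    [MetricSpace Z] [MeasurableSpace Z] [BorelSpace Z] [TopologicalSpace.SeparableSpace Z]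
    (p : ℝ) (hp : 1 ≤ p)
    (ω₁ : X₁ × X₁ → Z) (μ₁ : Measure X₁) (h₁ : IsNetwork p ω₁ μ₁)
    (ω₂ : X₂ × X₂ → Z) (μ₂ : Measure X₂) (h₂ : IsNetwork p ω₂ μ₂)
    (ω₃ : X₃ × X₃ → Z) (μ₃ : Measure X₃) (h₃ : IsNetwork p ω₃ μ₃) :
    GW p ω₁ μ₁ ω₂ μ₂ = GW p ω₂ μ₂ ω₁ μ₁ ∧
    0 ≤ GW p ω₁ μ₁ ω₂ μ₂ ∧
    GW p ω₁ μ₁ ω₃ μ₃ ≤ GW p ω₁ μ₁ ω₂ μ₂ + GW p ω₂ μ₂ ω₃ μ₃ := by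
  have : SecondCountableTopology Z := UniformSpace.secondCountable_of_separable Z
  exact ⟨GW_comm p ω₁ μ₁ ω₂ μ₂, GW_nonneg p ω₁ μ₁ ω₂ μ₂, h₁.GW_triangle h₂ h₃ hp⟩
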